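/- For all positive integers a and b, the order of K-promotion ∂ on Inc^{a+b}(a×b) is exactly a + b; that is, the least m > 0 with ∂^m equal to the identity on Inc^{a+b}(a×b) is a + b. -/

import Mathlib

open scoped Classical

/-- Two cells of `ℕ × ℕ` are horizontally or vertically adjacent. -/
def incAdj (c d : ℕ × ℕ) : Prop :=
  (c.1 = d.1 ∧ (c.2 + 1 = d.2 ∨ d.2 + 1 = c.2)) ∨
  (c.2 = d.2 ∧ (c.1 + 1 = d.1 ∨ d.1 + 1 = c.1))

/-- `T` is an increasing tableau on the cell set `μ` with entries in `{1,…,q}`: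
entries strictly increase along rows and down columns. -/
def IsIncTab (μ : Finset (ℕ × ℕ)) (q : ℕ) (T : ℕ × ℕ → ℕ) : Prop :=
  (∀ c ∈ μ, 1 ≤ T c ∧ T c ≤ q) ∧
  (∀ c ∈ μ, ∀ d ∈ μ, c.1 = d.1 → c.2 < d.2 → T c < T d) ∧
  (∀ c ∈ μ, ∀ d ∈ μ, c.2 = d.2 → c.1 < d.1 → T c < T d)

/-- The `i`-th K-Bender-Knuth involution: every entry `i` with no adjacent cell
containing `i+1` becomes `i+1`, and every entry `i+1` with no adjacent cell
containing `i` becomes `i`. -/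
noncomputable def kbkMap (μ : Finset (ℕ × ℕ)) (i : ℕ) (T : ℕ × ℕ → ℕ) : ℕ × ℕ → ℕ :=
  fun c =>
    if c ∈ μ ∧ T c = i ∧ ¬ ∃ d ∈ μ, incAdj c d ∧ T d = i + 1 then i + 1
    else if c ∈ μ ∧ T c = i + 1 ∧ ¬ ∃ d ∈ μ, incAdj c d ∧ T d = i then i
    else T c

/-- K-promotion `∂ = kbk_{q-1} ∘ ⋯ ∘ kbk_1` (with `kbk_1` applied first). -/
noncomputable def kPromo (μ : Finset (ℕ × ℕ)) (q : ℕ) (T : ℕ × ℕ → ℕ) : ℕ × ℕ → ℕ :=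
  (List.range (q - 1)).foldl (fun S k => kbkMap μ (k + 1) S) T

/-- The cells of the rectangular shape `a × b` (rows `0,…,a-1`, columns `0,…,b-1`). -/
def rectCells (a b : ℕ) : Finset (ℕ × ℕ) := Finset.range a ×ˢ Finset.range b

/-- Increasing tableaux of rectangular shape `a × b` with entries at most `q`,
represented canonically as functions `ℕ × ℕ → ℕ` vanishing off the rectangle. -/
def IncTabSet (a b q : ℕ) : Set (ℕ × ℕ → ℕ) :=
  {T | IsIncTab (rectCells a b) q T ∧ ∀ p : ℕ × ℕ, p ∉ rectCells a b → T p = 0}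

/-- Valid partitions in the `a × b` box. -/
structure KPValid (a b : ℕ) (l : ℕ → ℕ) : Prop where
  anti : ∀ i, l (i + 1) ≤ l i
  le : ∀ i, l i ≤ b
  zero : ∀ i, a ≤ i → l i = 0

/-- Auxiliary recursion for rowmotion on partitions. -/
def kpAux (b : ℕ) (l : ℕ → ℕ) : ℕ → ℕ
  | 0 => if l 1 < l 0 then l 0 - 1 else b
  | i + 1 => if l (i + 2) < l (i + 1) then l (i + 1) - 1 else kpAux b l i

/-- Rowmotion on partitions. -/
def kpStep (a b : ℕ) (l : ℕ → ℕ) : ℕ → ℕ := fun i => if i < a then kpAux b l i else 0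

/-- The partially toggled tableau. -/
noncomputable def kpMix (a b : ℕ) (T0 : ℕ × ℕ → ℕ) (l s : ℕ → ℕ) (k : ℕ) : ℕ × ℕ → ℕ := fun c =>
  if c.1 < a ∧ c.2 < b then
    c.1 + c.2 + 1 + (if c.2 < (if c.1 + c.2 < k then s c.1 else l c.1) then 0 else 1)
  else T0 c

/-- The Stanley-Thomas word. -/
def kpWord (a : ℕ) (l : ℕ → ℕ) (n : ℕ) : Prop :=
  if n < a then l (n + 1) < l n else ∀ i, l i ≠ n - a + 1

theorem KPValid.anti' {a b : ℕ} {l : ℕ → ℕ} (h : KPValid a b l) {i j : ℕ} (hij : i ≤ j) :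
    l j ≤ l i := antitone_nat_of_succ_le h.anti hij

theorem kpAux_ge {a b : ℕ} {l : ℕ → ℕ} (h : KPValid a b l) (i : ℕ) :
    l (i + 1) ≤ kpAux b l i := by
  induction i with
  | zero =>
    have := h.le 1
    simp only [kpAux]; split_ifs <;> simp <;> omega
  | succ i ih =>
    have : l (i + 2) ≤ l (i + 1) := h.anti (i + 1)
    show l (i + 2) ≤ _
    simp only [kpAux]; split_ifs <;> omega

theorem kpAux_anti {a b : ℕ} {l : ℕ → ℕ} (h : KPValid a b l) (i : ℕ) :
    kpAux b l (i + 1) ≤ kpAux b l i := by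
  have := kpAux_ge h i
  rw [kpAux]; split_ifs <;> omega

theorem kpAux_le {a b : ℕ} {l : ℕ → ℕ} (h : KPValid a b l) (i : ℕ) : kpAux b l i ≤ b := by
  induction i with
  | zero =>
    have := h.le 0
    simp only [kpAux]; split_ifs <;> omega
  | succ i ih => exact (kpAux_anti h i).trans ih

theorem kpStep_valid {a b : ℕ} {l : ℕ → ℕ} (h : KPValid a b l) : KPValid a b (kpStep a b l) := by
  refine ⟨fun i => ?_, fun i => ?_, fun i hi => ?_⟩
  · have := kpAux_anti h i
    simp only [kpStep]; split_ifs <;> omega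
  · have := kpAux_le h i
    simp only [kpStep]; split_ifs <;> omega
  · simp only [kpStep]; split_ifs <;> omega

theorem kpAux_corner {b : ℕ} {l : ℕ → ℕ} {i : ℕ} (h : l (i + 1) < l i) :
    kpAux b l i = l i - 1 := by
  cases i with
  | zero => simp only [kpAux]; exact if_pos h
  | succ i => simp only [kpAux]; exact if_pos h

theorem kpAux_form (b : ℕ) (l : ℕ → ℕ) (i : ℕ) :
    (∃ k ≤ i, l (k + 1) < l k ∧ kpAux b l i = l k - 1) ∨
      (kpAux b l i = b ∧ ¬ l 1 < l 0) := by
  induction i with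
  | zero =>
    by_cases h : l 1 < l 0
    · exact Or.inl ⟨0, le_rfl, h, kpAux_corner h⟩
    · right; simp only [kpAux]; exact ⟨if_neg h, h⟩
  | succ i ih =>
    by_cases h : l (i + 2) < l (i + 1)
    · exact Or.inl ⟨i + 1, le_rfl, h, kpAux_corner h⟩
    · simp only [kpAux]; rw [if_neg h]
      rcases ih with ⟨k, hk, h1, h2⟩ | h1
      · exact Or.inl ⟨k, by omega, h1, h2⟩
      · exact Or.inr h1

theorem exists_corner {a b : ℕ} {l : ℕ → ℕ} (h : KPValid a b l) {i : ℕ} (hi : 0 < l i) :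
    ∃ k < a, l (k + 1) < l k ∧ l k = l i := by
  by_contra hc
  push Not at hc
  have : ∀ n, l (i + n) = l i := by
    intro n
    induction n with
    | zero => rfl
    | succ n ih =>
      have h1 : i + n < a := by
        by_contra h2
        have := h.zero (i + n) (by omega)
        omega
      have h3 := h.anti (i + n)
      by_contra h4
      exact hc (i + n) h1 (by rw [← add_assoc] at h4; omega) ih
  have h1 := this a
  have := h.zero (i + a) (by omega)
  omega

theorem word_step {a b : ℕ} (ha : 0 < a) (hb : 0 < b) {l : ℕ → ℕ} (h : KPValid a b l) (n : ℕ)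
    (hn : n + 1 < a + b) : kpWord a (kpStep a b l) n ↔ kpWord a l (n + 1) := by
  rcases lt_trichotomy (n + 1) a with h1 | h1 | h1
  · -- inner row
    have hge := kpAux_ge h n
    simp only [kpWord, kpStep, if_pos h1, if_pos (show n < a by omega), kpAux]
    split_ifs with h2
    · simp only [h2, iff_true]; omega
    · simp [h2]
  · -- last row
    subst h1
    have hl := h.zero (n + 1) le_rfl
    simp only [kpWord, kpStep, lt_irrefl, if_false, Nat.lt_succ_self, if_true, Nat.sub_self,
      zero_add]
    constructor
    · intro h2 i hi
      obtain ⟨k, hk, hk1, hk2⟩ := exists_corner h (i := i) (by omega)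
      have h3 := antitone_nat_of_succ_le (kpAux_anti h) (show k ≤ n by omega)
      rw [kpAux_corner hk1] at h3
      omega
    · intro h2
      rcases kpAux_form b l n with ⟨k, hk, h3, h4⟩ | ⟨h3, -⟩
      · have := h2 k
        omega
      · omega
  · simp only [kpWord, if_neg (show ¬ n + 1 < a by omega), if_neg (show ¬ n < a by omega)]
    constructor
    · intro h2 i hi
      obtain ⟨k, hk, hk1, hk2⟩ := exists_corner h (i := i) (by omega)
      apply h2 k
      simp only [kpStep, if_pos hk]
      rw [kpAux_corner hk1]
      omega
    · intro h2 i hi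
      simp only [kpStep] at hi
      split_ifs at hi
      · rcases kpAux_form b l i with ⟨k, hk, h3, h4⟩ | ⟨h3, -⟩
        · have := h2 k
          omega
        · omega

theorem word_step_last {a b : ℕ} (ha : 0 < a) (hb : 0 < b) {l : ℕ → ℕ} (h : KPValid a b l) :
    kpWord a (kpStep a b l) (a + b - 1) ↔ kpWord a l 0 := by
  simp only [kpWord, if_neg (show ¬ a + b - 1 < a by omega), if_pos ha]
  constructor
  · intro h2
    by_contra h3
    apply h2 0
    simp only [kpStep, if_pos ha, kpAux, zero_add] at h3 ⊢
    rw [if_neg h3]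
    omega
  · intro h2 i hi
    simp only [kpStep] at hi
    split_ifs at hi
    · rcases kpAux_form b l i with ⟨k, hk, h3, h4⟩ | ⟨h3, h4⟩
      · have := h.le k
        omega
      · exact h4 h2

theorem iter_valid {a b : ℕ} {l : ℕ → ℕ} (h : KPValid a b l) (m : ℕ) :
    KPValid a b ((kpStep a b)^[m] l) := by
  induction m with
  | zero => exact h
  | succ m ih => rw [Function.iterate_succ_apply']; exact kpStep_valid ih

theorem word_iter {a b : ℕ} (ha : 0 < a) (hb : 0 < b) {l : ℕ → ℕ} (h : KPValid a b l) (m : ℕ) :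
    ∀ n < a + b, (kpWord a ((kpStep a b)^[m] l) n ↔ kpWord a l ((n + m) % (a + b))) := by
  induction m with
  | zero => intro n hn; simp [Nat.mod_eq_of_lt hn]
  | succ m ih =>
    intro n hn
    rw [Function.iterate_succ_apply']
    by_cases h1 : n + 1 < a + b
    · rw [word_step ha hb (iter_valid h m) n h1, ih _ h1]
      rw [show n + 1 + m = n + (m + 1) by omega]
    · obtain rfl : n = a + b - 1 := by omega
      rw [word_step_last ha hb (iter_valid h m), ih 0 (by omega)]
      rw [show a + b - 1 + (m + 1) = 0 + m + (a + b) by omega, Nat.add_mod_right]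

theorem word_inj_le {a b : ℕ} {l s : ℕ → ℕ} (hl : KPValid a b l) (hs : KPValid a b s)
    (hw : ∀ n < a + b, (kpWord a l n ↔ kpWord a s n)) {i : ℕ} (hi : i < a)
    (he : l (i + 1) = s (i + 1)) : s i ≤ l i := by
  have h0 := hw i (by omega)
  simp only [kpWord, if_pos hi] at h0
  have h1 := hl.anti i
  have h2 := hs.anti i
  by_cases h3 : l (i + 1) < l i
  · have h4 := hl.le i
    have h5 := hw (a + l i - 1) (by omega)
    simp only [kpWord, if_neg (show ¬ a + l i - 1 < a by omega)] at h5
    rw [show a + l i - 1 - a + 1 = l i by omega] at h5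
    have h6 : ¬ ∀ k, l k ≠ l i := fun h => h i rfl
    rw [h5] at h6
    push Not at h6
    obtain ⟨k, hk⟩ := h6
    have h7 : k ≤ i := by
      by_contra hc
      have := hs.anti' (show i + 1 ≤ k by omega)
      omega
    have := hs.anti' h7
    omega
  · have : ¬ s (i + 1) < s i := fun h => h3 (h0.2 h)
    omega

theorem word_inj {a b : ℕ} {l s : ℕ → ℕ} (hl : KPValid a b l) (hs : KPValid a b s)
    (hw : ∀ n < a + b, (kpWord a l n ↔ kpWord a s n)) : l = s := by
  have key : ∀ d i, a ≤ i + d → l i = s i := by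
    intro d
    induction d with
    | zero => intro i hi; rw [hl.zero i hi, hs.zero i hi]
    | succ d ih =>
      intro i hi
      by_cases h : i < a
      · have he := ih (i + 1) (by omega)
        exact le_antisymm (word_inj_le hs hl (fun n hn => (hw n hn).symm) h he.symm)
          (word_inj_le hl hs hw h he)
      · exact ih i (by omega)
  funext i
  exact key a i (by omega)

theorem mem_rect {a b : ℕ} {c : ℕ × ℕ} : c ∈ rectCells a b ↔ c.1 < a ∧ c.2 < b := by
  simp [rectCells]

theorem kpAux_ge' {a b : ℕ} {l : ℕ → ℕ} (h : KPValid a b l) (i : ℕ) :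
    l i ≤ kpAux b l i + 1 := by
  by_cases h1 : l (i + 1) < l i
  · rw [kpAux_corner h1]; omega
  · have := kpAux_ge h i
    omega

theorem kpMix_in {a b : ℕ} (T0 : ℕ × ℕ → ℕ) (l s : ℕ → ℕ) (k : ℕ) {i j : ℕ} (hi : i < a)
    (hj : j < b) : kpMix a b T0 l s k (i, j) =
      i + j + 1 + (if j < (if i + j < k then s i else l i) then 0 else 1) :=
  if_pos ⟨hi, hj⟩

theorem kbk_mix {a b : ℕ} {l : ℕ → ℕ} (h : KPValid a b l) (T0 : ℕ × ℕ → ℕ) (k : ℕ)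
    (hk : k + 2 ≤ a + b) :
    kbkMap (rectCells a b) (k + 1) (kpMix a b T0 l (kpAux b l) k) =
      kpMix a b T0 l (kpAux b l) (k + 1) := by
  funext ⟨i, j⟩
  by_cases hc : i < a ∧ j < b
  swap
  · have hc' : (i, j) ∉ rectCells a b := fun hh => hc (mem_rect.1 hh)
    simp [kbkMap, hc', kpMix, hc]
  obtain ⟨hi, hj⟩ := hc
  have hmem : (i, j) ∈ rectCells a b := mem_rect.2 ⟨hi, hj⟩
  have g1 := kpAux_ge h i
  have g2 := kpAux_ge' h i
  have g3 := kpAux_le h i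
  have g4 := h.anti i
  have g5 := h.le i
  have hM := kpMix_in T0 l (kpAux b l) k hi hj
  rw [kpMix_in T0 l (kpAux b l) (k + 1) hi hj]
  rcases lt_trichotomy (i + j) k with hr | hr | hr
  · rw [if_pos hr] at hM
    rw [if_pos (show i + j < k + 1 by omega), ← hM]
    have hle : kpMix a b T0 l (kpAux b l) k (i, j) ≤ k + 1 := by
      rw [hM]; split_ifs <;> omega
    have hblock : kpMix a b T0 l (kpAux b l) k (i, j) = k + 1 →
        ∃ d ∈ rectCells a b, incAdj (i, j) d ∧
          kpMix a b T0 l (kpAux b l) k d = k + 1 + 1 := by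
      intro he
      rw [hM] at he
      have hsj : ¬ j < kpAux b l i ∧ i + j + 1 = k := by
        split_ifs at he <;> omega
      by_cases hi1 : i + 1 < a
      · refine ⟨(i + 1, j), mem_rect.2 ⟨hi1, hj⟩, Or.inr ⟨rfl, Or.inl rfl⟩, ?_⟩
        rw [kpMix_in T0 l _ k hi1 hj, if_neg (show ¬ i + 1 + j < k by omega),
          if_neg (show ¬ j < l (i + 1) by omega)]
        omega
      · have hj1 : j + 1 < b := by omega
        refine ⟨(i, j + 1), mem_rect.2 ⟨hi, hj1⟩, Or.inl ⟨rfl, Or.inl rfl⟩, ?_⟩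
        rw [kpMix_in T0 l _ k hi hj1, if_neg (show ¬ i + (j + 1) < k by omega),
          if_neg (show ¬ j + 1 < l i by omega)]
        omega
    simp only [kbkMap]
    rw [if_neg (fun hh => hh.2.2 (hblock hh.2.1)), if_neg (fun hh => by have := hh.2.1; omega)]
  · rw [if_neg (show ¬ i + j < k by omega)] at hM
    rw [if_pos (show i + j < k + 1 by omega)]
    by_cases hjl : j < l i
    · rw [if_pos hjl] at hM
      have hM' : kpMix a b T0 l (kpAux b l) k (i, j) = k + 1 := by omega
      by_cases hcor : l (i + 1) ≤ j ∧ l i ≤ j + 1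
      · have hs := kpAux_corner (b := b) (show l (i + 1) < l i by omega)
        rw [if_neg (show ¬ j < kpAux b l i by omega)]
        simp only [kbkMap]
        rw [if_pos]
        · omega
        refine ⟨hmem, hM', ?_⟩
        rintro ⟨⟨i', j'⟩, hd, hadj, hv⟩
        obtain ⟨hi', hj'⟩ := mem_rect.1 hd
        simp only at hi' hj'
        rw [kpMix_in T0 l _ k hi' hj'] at hv
        simp only [incAdj] at hadj
        rcases hadj with ⟨rfl, rfl | h1⟩ | ⟨rfl, rfl | h1⟩ <;> split_ifs at hv <;> omega
      · rw [if_pos (show j < kpAux b l i by omega)]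
        have hblock : ∃ d ∈ rectCells a b, incAdj (i, j) d ∧
            kpMix a b T0 l (kpAux b l) k d = k + 1 + 1 := by
          by_cases h1 : l (i + 1) ≤ j
          · have hj1 : j + 1 < b := by omega
            refine ⟨(i, j + 1), mem_rect.2 ⟨hi, hj1⟩, Or.inl ⟨rfl, Or.inl rfl⟩, ?_⟩
            rw [kpMix_in T0 l _ k hi hj1, if_neg (show ¬ i + (j + 1) < k by omega),
              if_pos (show j + 1 < l i by omega)]
            omega
          · have hi1 : i + 1 < a := by
              by_contra hh
              have := h.zero (i + 1) (by omega)
              omega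
            refine ⟨(i + 1, j), mem_rect.2 ⟨hi1, hj⟩, Or.inr ⟨rfl, Or.inl rfl⟩, ?_⟩
            rw [kpMix_in T0 l _ k hi1 hj, if_neg (show ¬ i + 1 + j < k by omega),
              if_pos (show j < l (i + 1) by omega)]
            omega
        simp only [kbkMap]
        rw [if_neg (fun hh => hh.2.2 hblock), if_neg (fun hh => by have := hh.2.1; omega)]
        omega
    · rw [if_neg hjl] at hM
      have hM' : kpMix a b T0 l (kpAux b l) k (i, j) = k + 1 + 1 := by omega
      simp only [kbkMap]
      rw [if_neg (fun hh => by have := hh.2.1; omega)]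
      by_cases hjs : j < kpAux b l i
      · rw [if_pos hjs, if_pos]
        · omega
        refine ⟨hmem, hM', ?_⟩
        rintro ⟨⟨i', j'⟩, hd, hadj, hv⟩
        obtain ⟨hi', hj'⟩ := mem_rect.1 hd
        simp only at hi' hj'
        rw [kpMix_in T0 l _ k hi' hj'] at hv
        simp only [incAdj] at hadj
        rcases hadj with ⟨rfl, rfl | h1⟩ | ⟨rfl, rfl | rfl⟩
        · split_ifs at hv <;> omega
        · split_ifs at hv <;> omega
        · split_ifs at hv <;> omega
        · have := kpAux_anti h i'
          split_ifs at hv <;> omega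
      · rw [if_neg hjs]
        have hblock : ∃ d ∈ rectCells a b, incAdj (i, j) d ∧
            kpMix a b T0 l (kpAux b l) k d = k + 1 := by
          by_cases h1 : 0 < j ∧ kpAux b l i ≤ j - 1
          · have hj1 : j - 1 < b := by omega
            refine ⟨(i, j - 1), mem_rect.2 ⟨hi, hj1⟩, Or.inl ⟨rfl, Or.inr ?_⟩, ?_⟩
            · simp only; omega
            rw [kpMix_in T0 l _ k hi hj1, if_pos (show i + (j - 1) < k by omega),
              if_neg (show ¬ j - 1 < kpAux b l i by omega)]
            omega
          · have hnc : ¬ l (i + 1) < l i := by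
              intro hh
              have := kpAux_corner (b := b) hh
              omega
            cases i with
            | zero =>
              simp only [kpAux] at hjs
              rw [if_neg hnc] at hjs
              omega
            | succ i =>
              simp only [kpAux] at hjs
              rw [if_neg hnc] at hjs
              have hi1 : i < a := by omega
              refine ⟨(i, j), mem_rect.2 ⟨hi1, hj⟩, Or.inr ⟨rfl, Or.inr rfl⟩, ?_⟩
              rw [kpMix_in T0 l _ k hi1 hj, if_pos (show i + j < k by omega), if_neg hjs]
              omega
        rw [if_neg (fun hh => hh.2.2 hblock)]
        omega
  · rw [if_neg (show ¬ i + j < k by omega)] at hM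
    rw [if_neg (show ¬ i + j < k + 1 by omega), ← hM]
    have hle : k + 1 + 1 ≤ kpMix a b T0 l (kpAux b l) k (i, j) := by
      rw [hM]; split_ifs <;> omega
    have hblock : kpMix a b T0 l (kpAux b l) k (i, j) = k + 1 + 1 →
        ∃ d ∈ rectCells a b, incAdj (i, j) d ∧
          kpMix a b T0 l (kpAux b l) k d = k + 1 := by
      intro he
      rw [hM] at he
      have hsj : j < l i ∧ i + j = k + 1 := by
        split_ifs at he <;> omega
      cases i with
      | zero =>
        have hj1 : j - 1 < b := by omega
        refine ⟨(0, j - 1), mem_rect.2 ⟨hi, hj1⟩, Or.inl ⟨rfl, Or.inr ?_⟩, ?_⟩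
        · simp only; omega
        rw [kpMix_in T0 l _ k hi hj1, if_neg (show ¬ 0 + (j - 1) < k by omega),
          if_pos (show j - 1 < l 0 by omega)]
        omega
      | succ i =>
        have := h.anti i
        have hi1 : i < a := by omega
        refine ⟨(i, j), mem_rect.2 ⟨hi1, hj⟩, Or.inr ⟨rfl, Or.inr rfl⟩, ?_⟩
        rw [kpMix_in T0 l _ k hi1 hj, if_neg (show ¬ i + j < k by omega),
          if_pos (show j < l i by omega)]
        omega
    simp only [kbkMap]
    rw [if_neg (fun hh => by have := hh.2.1; omega), if_neg (fun hh => hh.2.2 (hblock hh.2.1))]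

theorem kPromo_mix {a b : ℕ} {l : ℕ → ℕ} (h : KPValid a b l) (T0 : ℕ × ℕ → ℕ) :
    ∀ k, k + 1 ≤ a + b →
    (List.range k).foldl (fun S k => kbkMap (rectCells a b) (k + 1) S)
      (kpMix a b T0 l (kpAux b l) 0) = kpMix a b T0 l (kpAux b l) k := by
  intro k
  induction k with
  | zero => intro _; rfl
  | succ k ih =>
    intro hk
    rw [List.range_succ, List.foldl_append, ih (by omega)]
    exact kbk_mix h T0 k (by omega)

/-- The tableau of a partition. -/
noncomputable def kpTab (a b : ℕ) (T0 : ℕ × ℕ → ℕ) (l : ℕ → ℕ) : ℕ × ℕ → ℕ := fun c =>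
  if c.1 < a ∧ c.2 < b then c.1 + c.2 + 1 + (if c.2 < l c.1 then 0 else 1) else T0 c

theorem kPromo_tab {a b : ℕ} (ha : 0 < a) (hb : 0 < b) {l : ℕ → ℕ} (h : KPValid a b l)
    (T0 : ℕ × ℕ → ℕ) :
    kPromo (rectCells a b) (a + b) (kpTab a b T0 l) = kpTab a b T0 (kpStep a b l) := by
  have h1 := kPromo_mix h T0 (a + b - 1) (by omega)
  have h2 : kpTab a b T0 l = kpMix a b T0 l (kpAux b l) 0 := by
    funext c; simp [kpTab, kpMix]
  rw [kPromo, h2, h1]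
  funext c
  simp only [kpTab, kpMix, kpStep]
  by_cases hc : c.1 < a ∧ c.2 < b
  · simp only [if_pos hc, if_pos hc.1, if_pos (show c.1 + c.2 < a + b - 1 by omega)]
  · simp only [if_neg hc]

theorem kPromo_iter {a b : ℕ} (ha : 0 < a) (hb : 0 < b) {l : ℕ → ℕ} (h : KPValid a b l)
    (T0 : ℕ × ℕ → ℕ) (m : ℕ) :
    (kPromo (rectCells a b) (a + b))^[m] (kpTab a b T0 l) =
      kpTab a b T0 ((kpStep a b)^[m] l) := by
  induction m with
  | zero => rfl
  | succ m ih =>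
    rw [Function.iterate_succ_apply', ih, kPromo_tab ha hb (iter_valid h m),
      Function.iterate_succ_apply']

theorem kpTab_inj {a b : ℕ} {l s : ℕ → ℕ} (hl : KPValid a b l) (hs : KPValid a b s)
    (T0 : ℕ × ℕ → ℕ) (he : kpTab a b T0 l = kpTab a b T0 s) : l = s := by
  funext i
  by_cases hi : i < a
  · have key : ∀ j < b, (j < l i ↔ j < s i) := by
      intro j hj
      have := congrFun he (i, j)
      simp only [kpTab, hi, hj, and_self, if_true] at this
      split_ifs at this <;> omega
    have h1 := hl.le i
    have h2 := hs.le i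
    rcases lt_trichotomy (l i) (s i) with h | h | h
    · have := key (l i) (by omega); omega
    · exact h
    · have := key (s i) (by omega); omega
  · rw [hl.zero i (by omega), hs.zero i (by omega)]

theorem tab_row {a b q : ℕ} {T : ℕ × ℕ → ℕ} (h : IsIncTab (rectCells a b) q T) {i : ℕ}
    (hi : i < a) (j d : ℕ) (hj : j + d < b) : T (i, j) + d ≤ T (i, j + d) := by
  induction d with
  | zero => simp
  | succ d ih =>
    have := ih (by omega)
    have := h.2.1 (i, j + d) (mem_rect.2 ⟨hi, by simp only; omega⟩) (i, j + (d + 1))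
      (mem_rect.2 ⟨hi, hj⟩) rfl (by simp only; omega)
    omega

theorem tab_col {a b q : ℕ} {T : ℕ × ℕ → ℕ} (h : IsIncTab (rectCells a b) q T) {j : ℕ}
    (hj : j < b) (i d : ℕ) (hi : i + d < a) : T (i, j) + d ≤ T (i + d, j) := by
  induction d with
  | zero => simp
  | succ d ih =>
    have := ih (by omega)
    have := h.2.2 (i + d, j) (mem_rect.2 ⟨by simp only; omega, hj⟩) (i + (d + 1), j)
      (mem_rect.2 ⟨hi, hj⟩) rfl (by simp only; omega)
    omega

theorem tab_bounds {a b : ℕ} {T : ℕ × ℕ → ℕ} (h : IsIncTab (rectCells a b) (a + b) T) {i j : ℕ}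
    (hi : i < a) (hj : j < b) : i + j + 1 ≤ T (i, j) ∧ T (i, j) ≤ i + j + 2 := by
  have h1 := tab_row h (i := 0) (by omega) 0 j (by omega)
  have h2 := tab_col h hj 0 i (by omega)
  have h3 := tab_row h hi j (b - 1 - j) (by omega)
  rw [show j + (b - 1 - j) = b - 1 by omega] at h3
  have h4 := tab_col h (show b - 1 < b by omega) i (a - 1 - i) (by omega)
  rw [show i + (a - 1 - i) = a - 1 by omega] at h4
  have h5 := h.1 (0, 0) (mem_rect.2 ⟨by simp only; omega, by simp only; omega⟩)
  have h6 := h.1 (a - 1, b - 1) (mem_rect.2 ⟨by simp only; omega, by simp only; omega⟩)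
  simp only [zero_add] at *
  omega

theorem exists_part {a b : ℕ} {T : ℕ × ℕ → ℕ} (h : IsIncTab (rectCells a b) (a + b) T) :
    ∃ l, KPValid a b l ∧ kpTab a b T l = T := by
  have hex : ∀ i, ∃ j, b ≤ j ∨ T (i, j) ≠ i + j + 1 := fun i => ⟨b, Or.inl le_rfl⟩
  refine ⟨fun i => if i < a then Nat.find (hex i) else 0, ⟨fun i => ?_, fun i => ?_,
    fun i hi => ?_⟩, ?_⟩
  · by_cases h1 : i + 1 < a
    · simp only [if_pos h1, if_pos (show i < a by omega)]
      apply Nat.find_min'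
      have hsp := Nat.find_spec (hex i)
      generalize Nat.find (hex i) = j at *
      by_cases hj : b ≤ j
      · exact Or.inl hj
      · have h2 := tab_bounds h (i := i) (j := j) (by omega) (by omega)
        have h3 := tab_col h (j := j) (by omega) i 1 h1
        right
        rcases hsp with h4 | h4 <;> omega
    · simp [h1]
  · split_ifs
    · exact Nat.find_min' _ (Or.inl le_rfl)
    · omega
  · exact if_neg (by omega)
  · funext ⟨i, j⟩
    simp only [kpTab]
    by_cases hc : i < a ∧ j < b
    · simp only [if_pos hc, if_pos hc.1]
      obtain ⟨hi, hj⟩ := hc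
      split_ifs with h1
      · have := Nat.find_min _ h1
        push Not at this
        omega
      · have hsp := Nat.find_spec (hex i)
        generalize Nat.find (hex i) = k at *
        have h2 := tab_bounds h hi hj
        have h3 := tab_row h hi k (j - k) (by omega)
        rw [show k + (j - k) = j by omega] at h3
        have h4 := tab_bounds h hi (show k < b by omega)
        rcases hsp with h5 | h5 <;> omega
    · simp only [if_neg hc]

theorem kpTab_inc {a b : ℕ} {l : ℕ → ℕ} (h : KPValid a b l) (T0 : ℕ × ℕ → ℕ) :
    IsIncTab (rectCells a b) (a + b) (kpTab a b T0 l) := by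
  refine ⟨?_, ?_, ?_⟩
  · intro c hc
    rw [mem_rect] at hc
    simp only [kpTab, if_pos hc]
    split_ifs <;> omega
  · rintro ⟨i, j⟩ hc ⟨i', j'⟩ hd h1 h2
    rw [mem_rect] at hc hd
    simp only at h1 h2
    subst h1
    simp only [kpTab, if_pos hc, if_pos hd]
    split_ifs <;> omega
  · rintro ⟨i, j⟩ hc ⟨i', j'⟩ hd h1 h2
    rw [mem_rect] at hc hd
    simp only at h1 h2
    subst h1
    have := h.anti' h2.le
    simp only [kpTab, if_pos hc, if_pos hd]
    split_ifs <;> omega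

/-- Corollary 4.8: the order of K-promotion on `Inc^{a+b}(a×b)` is exactly
`a + b`. -/
theorem order_kpromotion_ab (a b : ℕ) (ha : 0 < a) (hb : 0 < b) :
    IsLeast {m : ℕ | 0 < m ∧
      ∀ T : ℕ × ℕ → ℕ, IsIncTab (rectCells a b) (a + b) T →
        (kPromo (rectCells a b) (a + b))^[m] T = T} (a + b) := by
  constructor
  · refine ⟨by omega, fun T hT => ?_⟩
    obtain ⟨l, hl, he⟩ := exists_part hT
    have h1 := kPromo_iter ha hb hl T (a + b)
    have h2 : (kpStep a b)^[a + b] l = l := by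
      apply word_inj (iter_valid hl _) hl
      intro n hn
      rw [word_iter ha hb hl _ n hn, Nat.add_mod_right, Nat.mod_eq_of_lt hn]
    rw [h2, he] at h1
    exact h1
  · rintro m ⟨hm, hT⟩
    by_contra hlt
    have hv : KPValid a b (fun _ => 0) := ⟨by simp, by simp, by simp⟩
    have h1 := hT _ (kpTab_inc hv (fun _ => 0))
    rw [kPromo_iter ha hb hv] at h1
    have h2 := kpTab_inj (iter_valid hv m) hv _ h1
    have hw : ∀ n, kpWord a (fun _ => 0) n ↔ a ≤ n := by
      intro n
      by_cases h : n < a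
      · simp [kpWord, h]
      · simp [kpWord, h]; omega
    have key : ∀ n < a + b, (a ≤ n ↔ a ≤ (n + m) % (a + b)) := by
      intro n hn
      have := word_iter ha hb hv m n hn
      rwa [h2, hw, hw] at this
    by_cases hmb : m ≤ b
    · have := key (a - 1) (by omega)
      rw [Nat.mod_eq_of_lt (by omega)] at this
      omega
    · have := key (a + b - 1 - m) (by omega)
      rw [Nat.mod_eq_of_lt (by omega)] at this
      omega
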